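/- Let A₁ and A₂ be unital associative ℂ-algebras each of countable dimension over ℂ, let W₁ be a nonzero A₁-module and W₂ a nonzero A₂-module. Then the tensor product W₁ ⊗_ℂ W₂, as a module over A₁ ⊗_ℂ A₂ (with (a₁ ⊗ a₂)·(w₁ ⊗ w₂) = a₁w₁ ⊗ a₂w₂), is simple if and only if W₁ is a simple A₁-module and W₂ is a simple A₂-module. (Algebraic core of Theorem 3.6 of the paper: a tensor product strongly graded module W₁ ⊗ ··· ⊗ W_p for a tensor product of strongly graded conformal vertex algebras with countable grading groups is irreducible if and only if each W_i is irreducible; the proof uses Dixmier's lemma and the Jacobson density theorem.) -/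

import Mathlib

open Cardinal TensorProduct

universe u v

/-- If `f - a` is injective for every scalar `a`, then so is every nonzero polynomial in `f`. -/
theorem Module.End.aeval_injective_of_forall_sub_algebraMap {k V : Type*} [Field k] [IsAlgClosed k]
    [AddCommGroup V] [Module k V] (f : Module.End k V)
    (hf : ∀ a : k, Function.Injective (f - algebraMap k (Module.End k V) a))
    {p : Polynomial k} (hp : p ≠ 0) : Function.Injective (Polynomial.aeval f p) := by
  have hroots (m : Multiset k) :
      Function.Injective (Polynomial.aeval f (m.map (Polynomial.X - Polynomial.C ·)).prod) := by
    induction m using Multiset.induction_on with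
    | empty => simpa using! Function.injective_id
    | cons a m ih =>
      rw [Multiset.map_cons, Multiset.prod_cons, map_mul, map_sub, Polynomial.aeval_X,
        Polynomial.aeval_C]
      exact (hf a).comp ih
  rw [(IsAlgClosed.splits p).eq_prod_roots, map_mul, Polynomial.aeval_C]
  exact (smul_right_injective V (Polynomial.leadingCoeff_ne_zero.2 hp)).comp (hroots p.roots)

/-- If every `f - a` is injective and the vectors `u a` are preimages under `f - a` of a fixed
nonzero vector, then they are linearly independent. -/
theorem Module.End.linearIndependent_of_sub_algebraMap_apply_eq {k V : Type*} [Field k]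
    [IsAlgClosed k] [AddCommGroup V] [Module k V] (f : Module.End k V)
    (hf : ∀ a : k, Function.Injective (f - algebraMap k (Module.End k V) a))
    {w : V} (hw : w ≠ 0) {u : k → V} (hu : ∀ a, (f - algebraMap k (Module.End k V) a) (u a) = w) :
    LinearIndependent k u := by
  classical
  refine linearIndependent_iff'.2 fun s m hm i hi ↦ ?_
  let p : Polynomial k := ∑ j ∈ s, .C (m j) * ∏ l ∈ s.erase j, (.X - .C l)
  have hpw : Polynomial.aeval f p w = 0 := by
    have h := congrArg (Polynomial.aeval f (∏ l ∈ s, (Polynomial.X - Polynomial.C l))) hm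
    rw [map_zero, map_sum] at h
    rw [← h]
    simp only [p, map_sum, LinearMap.sum_apply]
    refine Finset.sum_congr rfl fun j hj ↦ ?_
    rw [← Finset.prod_erase_mul _ _ hj, map_mul, map_mul, Module.End.mul_apply,
      Module.End.mul_apply, map_smul, map_smul, ← hu j]
    simp
  have hp : p = 0 := by
    by_contra hp
    exact hw (f.aeval_injective_of_forall_sub_algebraMap hf hp (hpw.trans (map_zero _).symm))
  have he := congrArg (Polynomial.eval i) hp
  simp only [p, Polynomial.eval_finsetSum, Polynomial.eval_mul, Polynomial.eval_C,
    Polynomial.eval_prod, Polynomial.eval_sub, Polynomial.eval_X, Polynomial.eval_zero] at he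
  rw [Finset.sum_eq_single_of_mem i hi fun j hj hji ↦ by
    rw [Finset.prod_eq_zero (Finset.mem_erase.2 ⟨hji.symm, hi⟩) (sub_self i), mul_zero]] at he
  exact (mul_eq_zero.1 he).resolve_right
    (Finset.prod_ne_zero_iff.2 fun j hj ↦ sub_ne_zero.2 (Finset.ne_of_mem_erase hj).symm)

/-- Dixmier's lemma: Schur's lemma for a simple module over an algebra whose dimension is smaller
than the cardinality of the algebraically closed base field. -/
theorem IsSimpleModule.algebraMap_end_surjective_of_rank_lt {k : Type u} {A : Type v}
    {V : Type*} [Field k] [IsAlgClosed k] [Ring A] [Algebra k A] [AddCommGroup V] [Module k V] [Module A V]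
    [IsScalarTower k A V] [IsSimpleModule A V]
    (hA : lift.{u} (Module.rank k A) < lift.{v} #k) :
    Function.Surjective (algebraMap k (Module.End A V)) := by
  intro f
  by_contra! hf
  have hbij (a : k) : Function.Bijective (f - algebraMap k (Module.End A V) a) :=
    LinearMap.bijective_of_ne_zero fun h ↦ hf a (sub_eq_zero.1 h).symm
  have := IsSimpleModule.nontrivial A V
  obtain ⟨w, hw⟩ := exists_ne (0 : V)
  choose u hu using fun a ↦ (hbij a).2 w
  choose r hr using fun a ↦ IsSimpleModule.toSpanSingleton_surjective A hw (u a)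
  have hli : LinearIndependent k u :=
    Module.End.linearIndependent_of_sub_algebraMap_apply_eq (f.restrictScalars k)
      (fun a ↦ (hbij a).1) hw hu
  have hlr : LinearIndependent k r := by
    refine LinearIndependent.of_comp ((LinearMap.toSpanSingleton A V w).restrictScalars k) ?_
    convert hli using 1
    exact funext hr
  exact hA.not_ge hlr.cardinal_lift_le_rank

/-- The Jacobson density theorem for a simple module all of whose endomorphisms are scalars:
linear endomorphisms are interpolated on finite sets by the action of the algebra. -/
theorem IsSimpleModule.exists_smul_eq_of_algebraMap_end_surjective {k A V : Type*} [Field k]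
    [Ring A] [Algebra k A] [AddCommGroup V] [Module k V] [Module A V]
    [IsScalarTower k A V] [IsSimpleModule A V]
    (h : Function.Surjective (algebraMap k (Module.End A V)))
    (f : Module.End k V) (s : Finset V) : ∃ a : A, ∀ v ∈ s, f v = a • v :=
  jacobson_density (R := A)
    { f with
      map_smul' := fun g v ↦ by
        obtain ⟨c, rfl⟩ := h g
        exact map_smul f c v } s

/-- Over a field, a pure tensor of nonzero vectors is nonzero. -/
theorem TensorProduct.tmul_ne_zero_of_field {k V W : Type*} [Field k] [AddCommGroup V] [Module k V]
    [AddCommGroup W] [Module k W] {v : V} {w : W} (hv : v ≠ 0) (hw : w ≠ 0) : v ⊗ₜ[k] w ≠ 0 := by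
  have hinj := Module.Flat.lTensor_preserves_injective_linearMap (M := V)
    (LinearMap.toSpanSingleton k W w) (smul_left_injective k hw)
  intro h
  have h1 : v ⊗ₜ[k] (1 : k) = 0 := hinj (by simpa using h)
  exact hv (by simpa using congrArg (TensorProduct.rid k V) h1)

section TensorProduct

variable {k A₁ A₂ W₁ W₂ : Type*} [Field k]
  [Ring A₁] [Algebra k A₁] [Ring A₂] [Algebra k A₂]
  [AddCommGroup W₁] [Module k W₁] [Module A₁ W₁]
  [AddCommGroup W₂] [Module k W₂] [Module A₂ W₂]
  [Module (A₁ ⊗[k] A₂) (W₁ ⊗[k] W₂)]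

theorem IsSimpleModule.of_tensorProduct_left [IsScalarTower k A₁ W₁] [Nontrivial W₁] [Nontrivial W₂]
    (hsmul : ∀ (a₁ : A₁) (a₂ : A₂) (w₁ : W₁) (w₂ : W₂),
      (a₁ ⊗ₜ[k] a₂) • (w₁ ⊗ₜ[k] w₂) = (a₁ • w₁) ⊗ₜ[k] (a₂ • w₂))
    [IsSimpleModule (A₁ ⊗[k] A₂) (W₁ ⊗[k] W₂)] : IsSimpleModule A₁ W₁ := by
  refine isSimpleModule_iff_toSpanSingleton_surjective.2 ⟨‹_›, fun m hm w ↦ ?_⟩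
  obtain ⟨v, hv⟩ := exists_ne (0 : W₂)
  obtain ⟨t, ht⟩ := IsSimpleModule.toSpanSingleton_surjective (A₁ ⊗[k] A₂)
    (TensorProduct.tmul_ne_zero_of_field hm hv) (w ⊗ₜ[k] v)
  rw [LinearMap.toSpanSingleton_apply] at ht
  let q : W₁ →ₗ[k] W₁ ⧸ A₁ ∙ m := (A₁ ∙ m).mkQ.restrictScalars k
  have hq (t : A₁ ⊗[k] A₂) : q.rTensor W₂ (t • (m ⊗ₜ[k] v)) = 0 := by
    induction t with
    | zero => simp
    | add x y hx hy => rw [add_smul, map_add, hx, hy, add_zero]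
    | tmul a b =>
      have : q (a • m) = 0 := (Submodule.Quotient.mk_eq_zero _).2
        (Submodule.smul_mem _ a (Submodule.mem_span_singleton_self m))
      rw [hsmul, LinearMap.rTensor_tmul, this, TensorProduct.zero_tmul]
  have hw : q w = 0 := by
    by_contra hw
    exact TensorProduct.tmul_ne_zero_of_field hw hv (by rw [← LinearMap.rTensor_tmul, ← ht, hq])
  exact Submodule.mem_span_singleton.1 ((Submodule.Quotient.mk_eq_zero _).1 hw)

theorem IsSimpleModule.of_tensorProduct_right [IsScalarTower k A₂ W₂] [Nontrivial W₁] [Nontrivial W₂]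
    (hsmul : ∀ (a₁ : A₁) (a₂ : A₂) (w₁ : W₁) (w₂ : W₂),
      (a₁ ⊗ₜ[k] a₂) • (w₁ ⊗ₜ[k] w₂) = (a₁ • w₁) ⊗ₜ[k] (a₂ • w₂))
    [IsSimpleModule (A₁ ⊗[k] A₂) (W₁ ⊗[k] W₂)] : IsSimpleModule A₂ W₂ := by
  refine isSimpleModule_iff_toSpanSingleton_surjective.2 ⟨‹_›, fun m hm w ↦ ?_⟩
  obtain ⟨v, hv⟩ := exists_ne (0 : W₁)
  obtain ⟨t, ht⟩ := IsSimpleModule.toSpanSingleton_surjective (A₁ ⊗[k] A₂)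
    (TensorProduct.tmul_ne_zero_of_field hv hm) (v ⊗ₜ[k] w)
  rw [LinearMap.toSpanSingleton_apply] at ht
  let q : W₂ →ₗ[k] W₂ ⧸ A₂ ∙ m := (A₂ ∙ m).mkQ.restrictScalars k
  have hq (t : A₁ ⊗[k] A₂) : q.lTensor W₁ (t • (v ⊗ₜ[k] m)) = 0 := by
    induction t with
    | zero => simp
    | add x y hx hy => rw [add_smul, map_add, hx, hy, add_zero]
    | tmul a b =>
      have : q (b • m) = 0 := (Submodule.Quotient.mk_eq_zero _).2
        (Submodule.smul_mem _ b (Submodule.mem_span_singleton_self m))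
      rw [hsmul, LinearMap.lTensor_tmul, this, TensorProduct.tmul_zero]
  have hw : q w = 0 := by
    by_contra hw
    exact TensorProduct.tmul_ne_zero_of_field hv hw (by rw [← LinearMap.lTensor_tmul, ← ht, hq])
  exact Submodule.mem_span_singleton.1 ((Submodule.Quotient.mk_eq_zero _).1 hw)

/-- A tensor product of simple modules is simple if the second factor has only scalar
endomorphisms. -/
theorem IsSimpleModule.tensorProduct_of_algebraMap_end_surjective [IsScalarTower k A₂ W₂]
    (hsmul : ∀ (a₁ : A₁) (a₂ : A₂) (w₁ : W₁) (w₂ : W₂),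
      (a₁ ⊗ₜ[k] a₂) • (w₁ ⊗ₜ[k] w₂) = (a₁ • w₁) ⊗ₜ[k] (a₂ • w₂))
    [IsSimpleModule A₁ W₁] [IsSimpleModule A₂ W₂]
    (hend : Function.Surjective (algebraMap k (Module.End A₂ W₂))) :
    IsSimpleModule (A₁ ⊗[k] A₂) (W₁ ⊗[k] W₂) := by
  classical
  have := IsSimpleModule.nontrivial A₁ W₁
  have := IsSimpleModule.nontrivial A₂ W₂
  refine isSimpleModule_iff_toSpanSingleton_surjective.2 ⟨inferInstance, fun x hx y ↦ ?_⟩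
  let b := Module.Free.chooseBasis k W₂
  obtain ⟨c, rfl⟩ := TensorProduct.eq_repr_basis_right b x
  obtain ⟨j, hj⟩ : ∃ j, c j ≠ 0 := by
    by_contra! h
    exact hx (by simp [Finsupp.sum, h])
  obtain ⟨e, he⟩ := IsSimpleModule.exists_smul_eq_of_algebraMap_end_surjective hend
    (b.constr k (Pi.single j (b j))) (c.support.image b)
  have hpure : ((1 : A₁) ⊗ₜ[k] e) • (c.sum fun i m ↦ m ⊗ₜ[k] b i) = c j ⊗ₜ[k] b j := by
    rw [Finsupp.sum, Finset.smul_sum, Finset.sum_eq_single_of_mem j (by simpa using hj)]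
    · rw [hsmul, one_smul, ← he _ (Finset.mem_image_of_mem _ (by simpa using hj))]
      simp
    · intro i hi hij
      rw [hsmul, ← he _ (Finset.mem_image_of_mem _ hi)]
      simp [hij]
  induction y with
  | zero => exact ⟨0, by simp⟩
  | add y z hy hz =>
    obtain ⟨s, rfl⟩ := hy
    obtain ⟨t, rfl⟩ := hz
    exact ⟨s + t, map_add _ _ _⟩
  | tmul w₁ w₂ =>
    obtain ⟨a₁, rfl⟩ := IsSimpleModule.toSpanSingleton_surjective A₁ hj w₁
    obtain ⟨a₂, rfl⟩ := IsSimpleModule.toSpanSingleton_surjective A₂ (b.ne_zero j) w₂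
    refine ⟨(a₁ ⊗ₜ a₂) * (1 ⊗ₜ e), ?_⟩
    rw [LinearMap.toSpanSingleton_apply, mul_smul, hpure, hsmul]
    rfl

end TensorProduct

open Cardinal TensorProduct

/-- Algebraic core of Theorem 3.6: for unital associative ℂ-algebras `A₁`, `A₂` of
countable ℂ-dimension and nonzero modules `W₁`, `W₂`, the tensor product
`W₁ ⊗[ℂ] W₂`, as an `A₁ ⊗[ℂ] A₂`-module with the componentwise action, is simple
if and only if `W₁` and `W₂` are simple. -/
theorem tensorProduct_isSimpleModule_iff {A₁ A₂ W₁ W₂ : Type*}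
    [Ring A₁] [Algebra ℂ A₁] [Ring A₂] [Algebra ℂ A₂]
    [AddCommGroup W₁] [Module ℂ W₁] [Module A₁ W₁] [IsScalarTower ℂ A₁ W₁]
    [AddCommGroup W₂] [Module ℂ W₂] [Module A₂ W₂] [IsScalarTower ℂ A₂ W₂]
    (hA₁ : Module.rank ℂ A₁ ≤ ℵ₀) (hA₂ : Module.rank ℂ A₂ ≤ ℵ₀)
    [Nontrivial W₁] [Nontrivial W₂]
    [Module (A₁ ⊗[ℂ] A₂) (W₁ ⊗[ℂ] W₂)]
    (hsmul : ∀ (a₁ : A₁) (a₂ : A₂) (w₁ : W₁) (w₂ : W₂),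
      (a₁ ⊗ₜ[ℂ] a₂) • (w₁ ⊗ₜ[ℂ] w₂) = (a₁ • w₁) ⊗ₜ[ℂ] (a₂ • w₂)) :
    IsSimpleModule (A₁ ⊗[ℂ] A₂) (W₁ ⊗[ℂ] W₂) ↔
      IsSimpleModule A₁ W₁ ∧ IsSimpleModule A₂ W₂ := by
  refine ⟨fun h ↦ ⟨.of_tensorProduct_left hsmul, .of_tensorProduct_right hsmul⟩, fun ⟨_, _⟩ ↦
    .tensorProduct_of_algebraMap_end_surjective hsmul
      (IsSimpleModule.algebraMap_end_surjective_of_rank_lt ?_)⟩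
  simpa [mk_complex] using hA₂.trans_lt aleph0_lt_continuum
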